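/- For every z ∈ ℂ \ {0} and all k, ℓ ∈ ℤ, with B_j(z) := z^j A_{q²}(z² q^{2j+1}) for j ∈ ℤ, one has ∑_{n=−∞}^{∞} q^{n(n+k+ℓ)} ( B_{n+k}(z) B_{n+ℓ}(z) + B_{n+k}(−z^{−1}) B_{n+ℓ}(−z^{−1}) ) = 2 q^{−k²} (q²;q²)_∞² θ_{q²}(−q z²) δ_{k,ℓ}. -/

import Mathlib

open Complex Filter Topology

/-- Finite q-Pochhammer symbol `(a;q)_n`. -/
noncomputable def qp (q a : ℂ) (n : ℕ) : ℂ := ∏ k ∈ Finset.range n, (1 - a * q ^ k)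

/-- Infinite q-Pochhammer symbol `(a;q)_∞`. -/
noncomputable def qpInf (q a : ℂ) : ℂ := ∏' k : ℕ, (1 - a * q ^ k)

/-- Theta function `θ_q(x) = (x;q)_∞ (q/x;q)_∞`. -/
noncomputable def theta (q x : ℂ) : ℂ := qpInf q x * qpInf q (q / x)

/-- Ramanujan entire function with base `p`: `A_p(z) = ∑ (-1)^n p^{n²} z^n / (p;p)_n`. -/
noncomputable def ramanujanA (p z : ℂ) : ℂ :=
  ∑' n : ℕ, (-1) ^ n * p ^ (n ^ 2) * z ^ n / qp p p n

/-- `B_j(z) = z^j A_{q²}(z² q^{2j+1})`. -/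
noncomputable def Bfun (q : ℝ) (z : ℂ) (j : ℤ) : ℂ :=
  z ^ j * ramanujanA ((q : ℂ) ^ 2) (z ^ 2 * (q : ℂ) ^ (2 * j + 1))

lemma qp_succ (p a : ℂ) (n : ℕ) : qp p a (n + 1) = qp p a n * (1 - a * p ^ n) :=
  Finset.prod_range_succ _ _

lemma summable_norm_neg_mul_pow {p : ℂ} (hp : ‖p‖ < 1) (a : ℂ) :
    Summable fun k : ℕ => ‖-(a * p ^ k)‖ := by
  simp only [norm_neg, norm_mul, norm_pow]
  exact (summable_geometric_of_lt_one (norm_nonneg _) hp).mul_left _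

lemma multipliable_qp {p : ℂ} (hp : ‖p‖ < 1) (a : ℂ) :
    Multipliable fun k : ℕ => 1 - a * p ^ k := by
  simpa only [sub_eq_add_neg] using
    multipliable_one_add_of_summable (summable_norm_neg_mul_pow hp a)

lemma tendsto_qp {p : ℂ} (hp : ‖p‖ < 1) (a : ℂ) :
    Tendsto (qp p a) atTop (𝓝 (qpInf p a)) :=
  (multipliable_qp hp a).hasProd.tendsto_prod_nat

lemma one_sub_mul_pow_ne_zero {p : ℂ} (hp : ‖p‖ < 1) (k : ℕ) : 1 - p * p ^ k ≠ 0 := by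
  intro h
  have h1 : ‖p ^ (k + 1)‖ = 1 := by
    rw [pow_succ', ← sub_eq_zero.mp h, norm_one]
  rw [norm_pow] at h1
  exact absurd h1 (pow_lt_one₀ (norm_nonneg _) hp k.succ_ne_zero).ne

lemma qp_self_ne_zero {p : ℂ} (hp : ‖p‖ < 1) (n : ℕ) : qp p p n ≠ 0 :=
  Finset.prod_ne_zero_iff.mpr fun k _ => one_sub_mul_pow_ne_zero hp k

lemma qpInf_self_ne_zero {p : ℂ} (hp : ‖p‖ < 1) : qpInf p p ≠ 0 := by
  have h := tprod_one_add_ne_zero_of_summable (f := fun k : ℕ => -(p * p ^ k))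
    (fun k => by simpa only [← sub_eq_add_neg] using one_sub_mul_pow_ne_zero hp k)
    (summable_norm_neg_mul_pow hp p)
  simpa only [qpInf, sub_eq_add_neg] using h

lemma exists_norm_inv_qp_self_le {p : ℂ} (hp : ‖p‖ < 1) :
    ∃ C : ℝ, 0 ≤ C ∧ ∀ n, ‖(qp p p n)⁻¹‖ ≤ C := by
  obtain ⟨C, hC⟩ := (Metric.isBounded_range_of_tendsto _
    ((tendsto_qp hp p).inv₀ (qpInf_self_ne_zero hp))).exists_norm_le
  exact ⟨C, (norm_nonneg _).trans (hC _ ⟨0, rfl⟩), fun n => hC _ ⟨n, rfl⟩⟩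

lemma summable_norm_div_qp_self {p : ℂ} (hp : ‖p‖ < 1) {f : ℕ → ℂ}
    (hf : Summable fun n => ‖f n‖) : Summable fun n => ‖f n / qp p p n‖ := by
  obtain ⟨C, -, hC⟩ := exists_norm_inv_qp_self_le hp
  refine (hf.mul_right C).of_nonneg_of_le (fun _ => norm_nonneg _) fun n => ?_
  rw [div_eq_mul_inv, norm_mul]
  exact mul_le_mul_of_nonneg_left (hC n) (norm_nonneg _)

lemma summable_norm_pow_sq_mul_pow {q : ℂ} (hq : ‖q‖ < 1) (y : ℂ) :
    Summable fun n : ℕ => ‖q ^ (n ^ 2) * y ^ n‖ := by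
  have hlim : Tendsto (fun n : ℕ => ‖q‖ ^ n * ‖y‖) atTop (𝓝 0) := by
    simpa using (tendsto_pow_atTop_nhds_zero_of_lt_one (norm_nonneg q) hq).mul_const ‖y‖
  refine Summable.of_norm_bounded_eventually_nat (g := fun n : ℕ => (1 / 2 : ℝ) ^ n)
    (summable_geometric_of_lt_one (by norm_num) (by norm_num)) ?_
  filter_upwards [hlim.eventually_le_const (show (0 : ℝ) < 1 / 2 by norm_num)] with n hn
  rw [norm_norm, norm_mul, norm_pow, norm_pow, pow_two, pow_mul, ← mul_pow]
  exact pow_le_pow_left₀ (by positivity) hn n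

lemma summable_norm_zpow_sq_mul_zpow {q : ℂ} (hq : ‖q‖ < 1) (y : ℂ) :
    Summable fun n : ℤ => ‖q ^ (n ^ 2) * y ^ n‖ := by
  refine Summable.of_nat_of_neg ?_ ?_
  · refine (summable_norm_pow_sq_mul_pow hq y).congr fun n => ?_
    rw [← Nat.cast_pow, zpow_natCast, zpow_natCast]
  · refine (summable_norm_pow_sq_mul_pow hq y⁻¹).congr fun n => ?_
    rw [neg_sq, zpow_neg, ← Nat.cast_pow, zpow_natCast, zpow_natCast, inv_pow]

lemma tendsto_tsum_mul_pow_mul_pow {p y : ℂ} (hp : ‖p‖ < 1) {c : ℕ → ℂ}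
    (hc : Summable fun m => ‖c m * y ^ m‖) :
    Tendsto (fun N : ℕ => ∑' m, c m * (p ^ N * y) ^ m) atTop (𝓝 (c 0)) := by
  have h0 : ∑' m : ℕ, (if m = 0 then c 0 else 0) = c 0 := tsum_ite_eq 0 (fun _ => c 0)
  rw [← h0]
  refine tendsto_tsum_of_dominated_convergence hc (fun m => ?_) (.of_forall fun N m => ?_)
  · rcases eq_or_ne m 0 with rfl | hm
    · simp
    · have h1 : Tendsto (fun N : ℕ => (p ^ N * y) ^ m) atTop (𝓝 ((0 * y) ^ m)) :=
        ((tendsto_pow_atTop_nhds_zero_of_norm_lt_one hp).mul_const y).pow m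
      simpa [hm] using h1.const_mul (c m)
  · rw [norm_mul, norm_mul, mul_pow, norm_mul]
    refine mul_le_mul_of_nonneg_left ?_ (norm_nonneg _)
    refine mul_le_of_le_one_left (norm_nonneg _) ?_
    rw [norm_pow, norm_pow]
    exact pow_le_one₀ (by positivity) (pow_le_one₀ (norm_nonneg _) hp.le)

lemma norm_sq_lt_one {q : ℂ} (hq : ‖q‖ < 1) : ‖q ^ 2‖ < 1 := by
  rw [norm_pow]
  exact pow_lt_one₀ (norm_nonneg _) hq two_ne_zero

lemma summable_norm_euler {q : ℂ} (hq : ‖q‖ < 1) (y : ℂ) :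
    Summable fun m : ℕ => ‖(-1) ^ m * q ^ (m ^ 2) / qp (q ^ 2) (q ^ 2) m * y ^ m‖ := by
  convert summable_norm_div_qp_self (norm_sq_lt_one hq)
    (summable_norm_pow_sq_mul_pow hq (-y)) using 3 with m
  rw [neg_pow y]
  ring

/-- Euler's expansion of `(q y; q²)_∞`. -/
lemma hasSum_euler {q : ℂ} (hq : ‖q‖ < 1) (y : ℂ) :
    HasSum (fun m : ℕ => (-1) ^ m * q ^ (m ^ 2) / qp (q ^ 2) (q ^ 2) m * y ^ m)
      (qpInf (q ^ 2) (q * y)) := by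
  have hp := norm_sq_lt_one hq
  set c : ℕ → ℂ := fun m => (-1) ^ m * q ^ (m ^ 2) / qp (q ^ 2) (q ^ 2) m with hc
  set f : ℂ → ℂ := fun y => ∑' m, c m * y ^ m with hf
  have hs : ∀ y, Summable fun m => c m * y ^ m := fun y => (summable_norm_euler hq y).of_norm
  have hfun : ∀ y, f y = (1 - q * y) * f (q ^ 2 * y) := by
    intro y
    have h1 : f y - f (q ^ 2 * y) = ∑' m, (c m * y ^ m - c m * (q ^ 2 * y) ^ m) :=
      ((hs y).tsum_sub (hs _)).symm
    rw [((hs y).sub (hs _)).tsum_eq_zero_add] at h1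
    have h2 : ∀ m, c (m + 1) * y ^ (m + 1) - c (m + 1) * (q ^ 2 * y) ^ (m + 1)
        = -(q * y) * (c m * (q ^ 2 * y) ^ m) := by
      intro m
      have := qp_self_ne_zero hp m
      have h3 := one_sub_mul_pow_ne_zero hp m
      simp only [hc, qp_succ]
      field_simp
      ring
    simp only [h2, tsum_mul_left] at h1
    simp only [pow_zero, sub_self, zero_add] at h1
    linear_combination h1
  have hiter : ∀ N, f y = qp (q ^ 2) (q * y) N * f ((q ^ 2) ^ N * y) := by
    intro N
    induction N with
    | zero => simp [qp]
    | succ N ih =>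
      rw [ih, hfun, qp_succ, pow_succ']
      ring_nf
  have hlim : f y = qpInf (q ^ 2) (q * y) := by
    have h := (tendsto_qp hp (q * y)).mul
      (tendsto_tsum_mul_pow_mul_pow hp (summable_norm_euler hq y))
    have hconst : Tendsto (fun _ : ℕ => f y) atTop (𝓝 (f y)) := tendsto_const_nhds
    refine tendsto_nhds_unique (hconst.congr hiter) ?_
    convert h using 2
    simp [qp]
  rw [← hlim]
  exact (hs y).hasSum

lemma summable_norm_pow_div_qp {p x : ℂ} (hp : ‖p‖ < 1) (hx : ‖x‖ < 1) :
    Summable fun m : ℕ => ‖(qp p p m)⁻¹ * x ^ m‖ := by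
  convert summable_norm_div_qp_self hp (f := fun m => x ^ m) ?_ using 3 with m
  · rw [div_eq_inv_mul]
  · simpa only [norm_pow] using summable_geometric_of_lt_one (norm_nonneg _) hx

/-- Euler's expansion of `1 / (x; p)_∞`. -/
lemma qpInf_mul_tsum_pow_div_qp {p x : ℂ} (hp : ‖p‖ < 1) (hx : ‖x‖ < 1) :
    qpInf p x * ∑' m : ℕ, (qp p p m)⁻¹ * x ^ m = 1 := by
  set e : ℂ → ℂ := fun y => ∑' m, (qp p p m)⁻¹ * y ^ m with he
  have hfun : ∀ y, ‖y‖ < 1 → (1 - y) * e y = e (p * y) := by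
    intro y hy
    have hy' : ‖p * y‖ < 1 := by
      rw [norm_mul]
      exact mul_lt_one_of_nonneg_of_lt_one_left (norm_nonneg _) hp hy.le
    have hs := (summable_norm_pow_div_qp hp hy).of_norm
    have hs' := (summable_norm_pow_div_qp hp hy').of_norm
    have h1 := (hs.tsum_sub hs').symm
    rw [(hs.sub hs').tsum_eq_zero_add] at h1
    have h2 : ∀ m, (qp p p (m + 1))⁻¹ * y ^ (m + 1) - (qp p p (m + 1))⁻¹ * (p * y) ^ (m + 1)
        = y * ((qp p p m)⁻¹ * y ^ m) := by
      intro m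
      have := qp_self_ne_zero hp m
      have h3 := one_sub_mul_pow_ne_zero hp m
      simp only [qp_succ]
      field_simp
      ring
    simp only [h2, tsum_mul_left] at h1
    simp only [pow_zero, sub_self, zero_add] at h1
    simp only [he]
    linear_combination h1
  have hiter : ∀ N, qp p x N * e x = e (p ^ N * x) := by
    intro N
    induction N with
    | zero => simp [qp]
    | succ N ih =>
      have hN : ‖p ^ N * x‖ < 1 := by
        rw [norm_mul, norm_pow]
        exact mul_lt_one_of_nonneg_of_lt_one_right (pow_le_one₀ (norm_nonneg _) hp.le)
          (norm_nonneg _) hx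
      have h := hfun _ hN
      rw [qp_succ, pow_succ', mul_assoc p, ← h, ← ih]
      ring
  have h := (tendsto_qp hp x).mul_const (e x)
  have h' := tendsto_tsum_mul_pow_mul_pow hp (summable_norm_pow_div_qp hp hx)
  refine tendsto_nhds_unique (h.congr hiter) ?_
  convert h' using 2
  simp [qp]

lemma hasSum_mul_of_summable_norm {ι κ : Type*} {f : ι → ℂ} {g : κ → ℂ}
    (hf : Summable fun i => ‖f i‖) (hg : Summable fun j => ‖g j‖) :
    HasSum (fun x : ι × κ => f x.1 * g x.2) ((∑' i, f i) * ∑' j, g j) := by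
  rw [tsum_mul_tsum_of_summable_norm hf hg]
  exact (summable_mul_of_summable_norm hf hg).hasSum

lemma qpInf_eq_zero {p a : ℂ} {k : ℕ} (h : a * p ^ k = 1) : qpInf p a = 0 :=
  tprod_of_exists_eq_zero ⟨k, by rw [h, sub_self]⟩

lemma qpInf_eq_qp_mul {p : ℂ} (hp : ‖p‖ < 1) (a : ℂ) (n : ℕ) :
    qpInf p a = qp p a n * qpInf p (a * p ^ n) := by
  have h : Multipliable fun k : ℕ => 1 - a * p ^ (k + n) := by
    simpa only [pow_add, mul_assoc, mul_comm] using multipliable_qp hp (a * p ^ n)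
  rw [qpInf, ← h.prod_mul_tprod_nat_mul' (f := fun k : ℕ => 1 - a * p ^ k), qp, qpInf]
  congr 2
  ext k
  ring

/-- The shear `(n, b) ↦ (n + g b, b)` of `ℤ × β`. -/
def intShear {β : Type*} (g : β → ℤ) : ℤ × β ≃ ℤ × β where
  toFun x := (x.1 + g x.2, x.2)
  invFun x := (x.1 - g x.2, x.2)
  left_inv x := by simp
  right_inv x := by simp

lemma zpow_add_sq_mul_zpow_add {q y : ℂ} (hq0 : q ≠ 0) (hy : y ≠ 0) (c : ℂ) (n : ℤ) (m : ℕ) :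
    q ^ ((n + m) ^ 2) * y ^ (n + m) * (c⁻¹ * (-q / y) ^ m) =
      q ^ (n ^ 2) * y ^ n * ((-1) ^ m * q ^ (m ^ 2) / c * (q ^ (2 * n + 1)) ^ m) := by
  have h1 : q ^ ((n + m) ^ 2) = q ^ (n ^ 2) * q ^ (m ^ 2) * (q ^ (2 * n)) ^ m := by
    rw [← zpow_natCast (q ^ (2 * n)), ← zpow_mul, ← zpow_natCast q (m ^ 2), ← zpow_add₀ hq0,
      ← zpow_add₀ hq0]
    congr 1
    push_cast
    ring
  rw [h1, zpow_add₀ hy, zpow_natCast, zpow_add₀ hq0, zpow_one, neg_div, neg_pow, div_pow, mul_pow]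
  field_simp

lemma qpInf_zpow_eq_zero {q : ℂ} (hq0 : q ≠ 0) {n : ℤ} (hn : n < 0) :
    qpInf (q ^ 2) (q * q ^ (2 * n + 1)) = 0 := by
  obtain ⟨k, rfl⟩ : ∃ k : ℕ, n = -(k + 1 : ℤ) := ⟨(-n - 1).toNat, by omega⟩
  refine qpInf_eq_zero (k := k) ?_
  rw [← pow_mul, ← zpow_natCast, ← zpow_one_add₀ hq0, ← zpow_add₀ hq0]
  convert zpow_zero q using 2
  push_cast
  ring

lemma hasSum_qpInf_zpow {q : ℂ} (hq0 : q ≠ 0) (hq : ‖q‖ < 1) (y : ℂ) :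
    HasSum (fun n : ℤ => q ^ (n ^ 2) * y ^ n * qpInf (q ^ 2) (q * q ^ (2 * n + 1)))
      (qpInf (q ^ 2) (q ^ 2) * qpInf (q ^ 2) (-q * y)) := by
  have hp := norm_sq_lt_one hq
  have hinj : Function.Injective ((↑) : ℕ → ℤ) := Nat.cast_injective
  rw [← hinj.hasSum_iff]
  · have h2 := (hasSum_euler hq (-y)).mul_left (qpInf (q ^ 2) (q ^ 2))
    rw [neg_mul, ← mul_neg]
    refine h2.congr_fun fun n => ?_
    have h3 := qpInf_eq_qp_mul hp (q ^ 2) n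
    have h4 : q * q ^ (2 * (n : ℤ) + 1) = q ^ 2 * (q ^ 2) ^ n := by
      rw [← zpow_one_add₀ hq0, ← pow_mul, ← pow_add, ← zpow_natCast q (2 + 2 * n)]
      congr 1
      push_cast
      ring
    have h5 := qp_self_ne_zero hp n
    have h6 : ((-1 : ℂ) ^ n) ^ 2 = 1 := by rw [← pow_mul, mul_comm, pow_mul, neg_one_sq, one_pow]
    rw [Function.comp_apply, h4, ← Nat.cast_pow, zpow_natCast, zpow_natCast, neg_pow y, h3]
    field_simp
    rw [h6]
    ring
  · intro n hn
    have hneg : n < 0 := by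
      by_contra h
      exact hn ⟨n.toNat, by simp; omega⟩
    rw [qpInf_zpow_eq_zero hq0 hneg, mul_zero]

lemma tsum_zpow_sq_mul_zpow_of_norm_lt {q y : ℂ} (hq0 : q ≠ 0) (hq : ‖q‖ < 1) (hy : y ≠ 0)
    (hqy : ‖-q / y‖ < 1) :
    ∑' n : ℤ, q ^ (n ^ 2) * y ^ n =
      qpInf (q ^ 2) (q ^ 2) * (qpInf (q ^ 2) (-q * y) * qpInf (q ^ 2) (-q / y)) := by
  have hp := norm_sq_lt_one hq
  have hΘ := summable_norm_zpow_sq_mul_zpow hq y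
  have he := summable_norm_pow_div_qp hp hqy
  have hG := hasSum_mul_of_summable_norm hΘ he
  rw [← (intShear fun m : ℕ => (m : ℤ)).hasSum_iff] at hG
  have hfib := hG.prod_fiberwise
    (g := fun n : ℤ => q ^ (n ^ 2) * y ^ n * qpInf (q ^ 2) (q * q ^ (2 * n + 1))) fun n =>
      ((hasSum_euler hq (q ^ (2 * n + 1))).mul_left (q ^ (n ^ 2) * y ^ n)).congr_fun
        fun m => zpow_add_sq_mul_zpow_add hq0 hy _ n m
  have h3 := hfib.unique (hasSum_qpInf_zpow hq0 hq y)
  have h4 := qpInf_mul_tsum_pow_div_qp hp hqy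
  linear_combination qpInf (q ^ 2) (-q / y) * h3 - (∑' n : ℤ, q ^ (n ^ 2) * y ^ n) * h4

lemma tsum_zpow_sq_mul_zpow_inv (q y : ℂ) :
    ∑' n : ℤ, q ^ (n ^ 2) * y⁻¹ ^ n = ∑' n : ℤ, q ^ (n ^ 2) * y ^ n := by
  rw [← (Equiv.neg ℤ).tsum_eq]
  simp

/-- The Jacobi triple product identity. -/
lemma hasSum_zpow_sq_mul_zpow {q y : ℂ} (hq0 : q ≠ 0) (hq : ‖q‖ < 1) (hy : y ≠ 0) :
    HasSum (fun n : ℤ => q ^ (n ^ 2) * y ^ n)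
      (qpInf (q ^ 2) (q ^ 2) * theta (q ^ 2) (-q * y)) := by
  rw [(summable_norm_zpow_sq_mul_zpow hq y).of_norm.hasSum_iff]
  have h1 : q ^ 2 / (-q * y) = -q / y := by
    field_simp
  rw [theta, h1]
  rcases le_total 1 ‖y‖ with h | h
  · refine tsum_zpow_sq_mul_zpow_of_norm_lt hq0 hq hy ?_
    rw [norm_div, norm_neg]
    exact (div_le_self (norm_nonneg _) h).trans_lt hq
  · rw [← tsum_zpow_sq_mul_zpow_inv, tsum_zpow_sq_mul_zpow_of_norm_lt hq0 hq (inv_ne_zero hy) ?_]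
    · rw [div_inv_eq_mul, ← div_eq_mul_inv, mul_comm (qpInf _ (-q / y))]
    · rw [div_inv_eq_mul, norm_mul, norm_neg]
      exact (mul_le_of_le_one_right (norm_nonneg _) h).trans_lt hq

/-- The coefficient `(-q)^m (-q)^n / ((q²;q²)_m (q²;q²)_n) q^{(m-n)²} y^{m-n}` that remains after
shearing a product of two Ramanujan functions. -/
noncomputable def shearKernel (q y : ℂ) (x : ℕ × ℕ) : ℂ :=
  (qp (q ^ 2) (q ^ 2) x.1)⁻¹ * (-q) ^ x.1 * ((qp (q ^ 2) (q ^ 2) x.2)⁻¹ * (-q) ^ x.2) *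
    (q ^ ((x.1 - x.2 : ℤ) ^ 2) * y ^ (x.1 - x.2 : ℤ))

lemma summable_norm_shearKernel {q : ℂ} (hq : ‖q‖ < 1) (y : ℂ) :
    Summable fun x => ‖shearKernel q y x‖ := by
  have hs := summable_norm_zpow_sq_mul_zpow hq y
  have he := summable_norm_pow_div_qp (norm_sq_lt_one hq) ((norm_neg q).trans_lt hq)
  refine ((he.mul_norm he).mul_right (∑' n : ℤ, ‖q ^ (n ^ 2) * y ^ n‖)).of_nonneg_of_le
    (fun _ => norm_nonneg _) fun x => ?_
  rw [shearKernel, norm_mul]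
  exact mul_le_mul_of_nonneg_left (hs.le_tsum _ fun _ _ => norm_nonneg _) (norm_nonneg _)

lemma shearKernel_swap (q y : ℂ) (x : ℕ × ℕ) :
    shearKernel q y x.swap = shearKernel q y⁻¹ x := by
  have h : (x.2 - x.1 : ℤ) = -(x.1 - x.2) := by ring
  rw [shearKernel, shearKernel, Prod.fst_swap, Prod.snd_swap, h, neg_sq, zpow_neg, inv_zpow]
  ring

lemma shearKernel_zpow {q : ℂ} (hq0 : q ≠ 0) (r : ℤ) (m n : ℕ) :
    shearKernel q (q ^ (2 * r)) (m, n) =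
      (qp (q ^ 2) (q ^ 2) m)⁻¹ * (-q) ^ m * (q ^ (m ^ 2 + 2 * r * m : ℤ)) *
        ((-1) ^ n * q ^ (n ^ 2) / qp (q ^ 2) (q ^ 2) n * (q ^ (2 * (-m - r : ℤ) + 1)) ^ n) := by
  have h : q ^ ((m - n : ℤ) ^ 2) * (q ^ (2 * r)) ^ (m - n : ℤ) * q ^ n =
      q ^ (m ^ 2 + 2 * r * m : ℤ) * q ^ (n ^ 2) * (q ^ (2 * (-m - r : ℤ) + 1)) ^ n := by
    simp only [← zpow_natCast, ← zpow_mul, ← zpow_add₀ hq0]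
    congr 1
    push_cast
    ring
  rw [shearKernel, neg_pow q n]
  linear_combination (qp (q ^ 2) (q ^ 2) m)⁻¹ * (-q) ^ m * (qp (q ^ 2) (q ^ 2) n)⁻¹ * (-1) ^ n * h

lemma hasSum_shearKernel_of_nonneg {q : ℂ} (hq0 : q ≠ 0) (hq : ‖q‖ < 1) {r : ℤ} (hr : 0 ≤ r) :
    HasSum (shearKernel q (q ^ (2 * r))) (if r = 0 then qpInf (q ^ 2) (q ^ 2) else 0) := by
  have hs := (summable_norm_shearKernel hq (q ^ (2 * r))).of_norm.hasSum
  have hfib := hs.prod_fiberwise fun m =>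
    ((hasSum_euler hq (q ^ (2 * (-m - r : ℤ) + 1))).mul_left _).congr_fun
      fun n => shearKernel_zpow hq0 r m n
  have hzero : ∀ m : ℕ, m ≠ 0 ∨ r ≠ 0 →
      qpInf (q ^ 2) (q * q ^ (2 * (-m - r : ℤ) + 1)) = 0 := fun m hm =>
    qpInf_zpow_eq_zero hq0 (by omega)
  have hsum := hasSum_single (f := fun m : ℕ => (qp (q ^ 2) (q ^ 2) m)⁻¹ * (-q) ^ m *
    (q ^ (m ^ 2 + 2 * r * m : ℤ)) * qpInf (q ^ 2) (q * q ^ (2 * (-m - r : ℤ) + 1))) 0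
    fun m hm => by rw [hzero m (.inl hm), mul_zero]
  rw [hfib.unique hsum] at hs
  split_ifs with h
  · subst h
    simpa [qp, sq] using hs
  · rwa [hzero 0 (.inr h), mul_zero] at hs

lemma hasSum_shearKernel {q : ℂ} (hq0 : q ≠ 0) (hq : ‖q‖ < 1) (r : ℤ) :
    HasSum (shearKernel q (q ^ (2 * r))) (if r = 0 then qpInf (q ^ 2) (q ^ 2) else 0) := by
  rcases le_total 0 r with hr | hr
  · exact hasSum_shearKernel_of_nonneg hq0 hq hr
  · have h := hasSum_shearKernel_of_nonneg hq0 hq (neg_nonneg.mpr hr)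
    rw [← (Equiv.prodComm ℕ ℕ).hasSum_iff] at h
    simp only [neg_eq_zero] at h
    refine h.congr_fun fun x => ?_
    rw [Function.comp_apply, Equiv.prodComm_apply, shearKernel_swap, ← zpow_neg, mul_neg, neg_neg]

/-- The summand of `∑ₛ q^{s² + c s} z^{2s + c}`. -/
noncomputable def thetaTerm (q z : ℂ) (c s : ℤ) : ℂ := q ^ (s ^ 2 + c * s) * z ^ (2 * s + c)

lemma thetaTerm_eq {q z : ℂ} (hq0 : q ≠ 0) (hz : z ≠ 0) (c s : ℤ) :
    thetaTerm q z c s = q ^ (s ^ 2) * (q ^ c * z ^ 2) ^ s * z ^ c := by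
  rw [thetaTerm, zpow_add₀ hq0, zpow_add₀ hz, mul_zpow, zpow_mul q, zpow_mul z, zpow_ofNat]
  ring

lemma summable_norm_thetaTerm {q z : ℂ} (hq0 : q ≠ 0) (hq : ‖q‖ < 1) (hz : z ≠ 0) (c : ℤ) :
    Summable fun s => ‖thetaTerm q z c s‖ := by
  simp only [thetaTerm_eq hq0 hz, norm_mul _ (z ^ c)]
  exact (summable_norm_zpow_sq_mul_zpow hq _).mul_right _

lemma tsum_thetaTerm_neg_inv (q z : ℂ) (c : ℤ) :
    ∑' s, thetaTerm q (-z⁻¹) c s = (-1) ^ c * ∑' s, thetaTerm q z c s := by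
  rw [← tsum_mul_left, ← (Equiv.subLeft (-c)).tsum_eq]
  refine tsum_congr fun s => ?_
  have h1 : (-c - s) ^ 2 + c * (-c - s) = s ^ 2 + c * s := by ring
  have h2 : 2 * (-c - s) + c = -(2 * s + c) := by ring
  have h3 : (-1 : ℂ) ^ (2 * s + c) = (-1) ^ c := by
    rw [zpow_add₀ (by norm_num), zpow_mul]
    simp
  rw [Equiv.subLeft_apply, thetaTerm, thetaTerm, h1, h2, neg_eq_neg_one_mul z⁻¹, mul_zpow,
    inv_zpow, zpow_neg z, inv_inv, zpow_neg, h3, ← inv_zpow, inv_neg_one]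
  ring

lemma hasSum_thetaTerm_two_mul {q z : ℂ} (hq0 : q ≠ 0) (hq : ‖q‖ < 1) (hz : z ≠ 0) (t : ℤ) :
    HasSum (thetaTerm q z (2 * t))
      (q ^ (-t ^ 2) * (qpInf (q ^ 2) (q ^ 2) * theta (q ^ 2) (-q * z ^ 2))) := by
  have h := (hasSum_zpow_sq_mul_zpow hq0 hq (pow_ne_zero 2 hz)).mul_left (q ^ (-t ^ 2))
  rw [← (Equiv.addRight t).hasSum_iff] at h
  refine h.congr_fun fun s => ?_
  have h1 : z ^ (2 * s + 2 * t) = (z ^ 2) ^ (s + t) := by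
    rw [← mul_add, zpow_mul, zpow_two, sq]
  rw [Function.comp_apply, Equiv.coe_addRight, thetaTerm, h1, ← mul_assoc, ← zpow_add₀ hq0]
  congr 2
  ring

/-- The summand of the series of `B_j`. -/
noncomputable def bTerm (q z : ℂ) (j : ℤ) (m : ℕ) : ℂ :=
  (qp (q ^ 2) (q ^ 2) m)⁻¹ * (-1) ^ m * (q ^ (2 * m ^ 2 + (2 * j + 1) * m : ℤ) * z ^ (j + 2 * m))

lemma bTerm_eq {q z : ℂ} (hq0 : q ≠ 0) (hz : z ≠ 0) (j : ℤ) (m : ℕ) :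
    bTerm q z j m = z ^ j * ((-1) ^ m * (q ^ 2) ^ (m ^ 2) * (z ^ 2 * q ^ (2 * j + 1)) ^ m /
      qp (q ^ 2) (q ^ 2) m) := by
  have h1 : q ^ (2 * m ^ 2 + (2 * j + 1) * m : ℤ) =
      (q ^ 2) ^ (m ^ 2) * (q ^ (2 * j + 1)) ^ m := by
    simp only [← zpow_natCast, ← zpow_mul, ← zpow_add₀ hq0]
    congr 1
  have h2 : z ^ (j + 2 * m) = z ^ j * (z ^ 2) ^ m := by
    simp only [← zpow_natCast, ← zpow_mul, ← zpow_add₀ hz]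
    congr 1
  rw [bTerm, h1, h2, mul_pow (z ^ 2)]
  ring

lemma summable_norm_bTerm {q z : ℂ} (hq0 : q ≠ 0) (hq : ‖q‖ < 1) (hz : z ≠ 0) (j : ℤ) :
    Summable fun m => ‖bTerm q z j m‖ := by
  have hp := norm_sq_lt_one hq
  have hs := summable_norm_div_qp_self hp
    (summable_norm_pow_sq_mul_pow hp (-(z ^ 2 * q ^ (2 * j + 1))))
  refine (hs.mul_left ‖z ^ j‖).congr fun m => ?_
  rw [bTerm_eq hq0 hz, ← norm_mul, neg_pow (z ^ 2 * _)]
  ring_nf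

lemma Bfun_eq_tsum {q : ℝ} {z : ℂ} (hq0 : (q : ℂ) ≠ 0) (hz : z ≠ 0) (j : ℤ) :
    Bfun q z j = ∑' m, bTerm q z j m := by
  simp only [bTerm_eq hq0 hz, tsum_mul_left]
  rfl

lemma thetaTerm_mul_shearKernel {q z : ℂ} (hq0 : q ≠ 0) (hz : z ≠ 0) (k l n : ℤ) (m m' : ℕ) :
    thetaTerm q z (k + l) (n + (m + m')) * shearKernel q (q ^ (k - l)) (m, m') =
      q ^ (n * (n + k + l)) * (bTerm q z (n + k) m * bTerm q z (n + l) m') := by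
  have h1 : q ^ ((n + (m + m')) ^ 2 + (k + l) * (n + (m + m'))) * q ^ m * q ^ m' *
      (q ^ ((m - m' : ℤ) ^ 2) * (q ^ (k - l)) ^ (m - m' : ℤ)) =
      q ^ (n * (n + k + l)) * q ^ (2 * m ^ 2 + (2 * (n + k) + 1) * m : ℤ) *
        q ^ (2 * m' ^ 2 + (2 * (n + l) + 1) * m' : ℤ) := by
    simp only [← zpow_natCast, ← zpow_mul, ← zpow_add₀ hq0]
    congr 1
    ring
  have h2 : z ^ (2 * (n + (m + m')) + (k + l)) = z ^ (n + k + 2 * m) * z ^ (n + l + 2 * m') := by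
    rw [← zpow_add₀ hz]
    congr 1
    ring
  rw [thetaTerm, shearKernel, bTerm, bTerm, h2, neg_pow q m, neg_pow q m']
  linear_combination (qp (q ^ 2) (q ^ 2) m)⁻¹ * (qp (q ^ 2) (q ^ 2) m')⁻¹ * (-1) ^ m *
    (-1) ^ m' * (z ^ (n + k + 2 * m) * z ^ (n + l + 2 * m')) * h1

lemma hasSum_Bfun_mul_Bfun {q : ℝ} {z : ℂ} (hq0 : (q : ℂ) ≠ 0) (hq : ‖(q : ℂ)‖ < 1) (hz : z ≠ 0)
    (k l : ℤ) :
    HasSum (fun n : ℤ => (q : ℂ) ^ (n * (n + k + l)) * (Bfun q z (n + k) * Bfun q z (n + l)))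
      ((∑' s, thetaTerm q z (k + l) s) * ∑' x, shearKernel q ((q : ℂ) ^ (k - l)) x) := by
  have hG := hasSum_mul_of_summable_norm (summable_norm_thetaTerm hq0 hq hz (k + l))
    (summable_norm_shearKernel hq ((q : ℂ) ^ (k - l)))
  rw [← (intShear fun x : ℕ × ℕ => (x.1 + x.2 : ℤ)).hasSum_iff] at hG
  refine hG.prod_fiberwise fun n => ?_
  rw [Bfun_eq_tsum hq0 hz, Bfun_eq_tsum hq0 hz]
  exact ((hasSum_mul_of_summable_norm (summable_norm_bTerm hq0 hq hz (n + k))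
    (summable_norm_bTerm hq0 hq hz (n + l))).mul_left _).congr_fun
      fun x => thetaTerm_mul_shearKernel hq0 hz k l n x.1 x.2

theorem stmt_10 (q : ℝ) (hq0 : 0 < q) (hq1 : q < 1) (z : ℂ) (hz : z ≠ 0) (k l : ℤ) :
    HasSum (fun n : ℤ => (q : ℂ) ^ (n * (n + k + l)) *
        (Bfun q z (n + k) * Bfun q z (n + l) +
          Bfun q (-z⁻¹) (n + k) * Bfun q (-z⁻¹) (n + l)))
      (2 * (q : ℂ) ^ (-k ^ 2) * qpInf ((q : ℂ) ^ 2) ((q : ℂ) ^ 2) ^ 2 *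
        theta ((q : ℂ) ^ 2) (-(q : ℂ) * z ^ 2) * (if k = l then 1 else 0)) := by
  have hq0' : (q : ℂ) ≠ 0 := by exact_mod_cast hq0.ne'
  have hq : ‖(q : ℂ)‖ < 1 := by rwa [Complex.norm_real, Real.norm_of_nonneg hq0.le]
  have hsum := (hasSum_Bfun_mul_Bfun hq0' hq hz k l).add
    (hasSum_Bfun_mul_Bfun hq0' hq (neg_ne_zero.mpr (inv_ne_zero hz)) k l)
  simp only [← mul_add] at hsum
  convert hsum using 1
  rw [tsum_thetaTerm_neg_inv]
  rcases Int.even_or_odd (k - l) with ⟨r, hr⟩ | hodd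
  · obtain rfl : k = l + 2 * r := by omega
    have h1 : l + 2 * r + l = 2 * (l + r) := by ring
    have h2 : l + 2 * r - l = 2 * r := by ring
    have h3 : l + 2 * r = l ↔ r = 0 := by omega
    have h4 : (-1 : ℂ) ^ (2 * (l + r)) = 1 := by simp [zpow_mul]
    rw [h1, h2, h4, (hasSum_thetaTerm_two_mul hq0' hq hz (l + r)).tsum_eq,
      (hasSum_shearKernel hq0' hq r).tsum_eq]
    simp only [h3]
    split_ifs with h
    · subst h
      simp only [mul_zero, add_zero]
      ring
    · simp
  · have hne : k ≠ l := by
      rintro rfl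
      simp at hodd
    have h1 : Odd (k + l) := by
      rw [Int.odd_add]
      rwa [Int.odd_sub] at hodd
    rw [if_neg hne, h1.neg_one_zpow]
    ring
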